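/- arXiv:1804.01416 — 7 statements merged into one kernel-verified Lean document; each statement's English description precedes it below -/
import Mathlib

section
/- Let G = (V, E) be a simple graph and let S = {s₁, …, s₅} be five distinct vertices. Assume that (a) every pair s_i, s_j (i ≠ j) has at least 21 common neighbors outside S, i.e. #(N_G(s_i) ∩ N_G(s_j) \ S) ≥ 21, and (b) at most 20 vertices of V \ S are adjacent to three or more elements of S. Then there exists a family (v_{ij})_{1 ≤ i < j ≤ 5} of pairwise distinct vertices, each not in S, such that v_{ij} is adjacent to s_i and to s_j and is not adjacent to any s_k with k ∉ {i, j}. -/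
open scoped Classical

/-- Key intermediate construction in the proof of Proposition 5.1: if every pair among
five distinct vertices has at least `21` common neighbors outside `S = {s 0, …, s 4}`,
and at most `20` vertices outside `S` are adjacent to three or more elements of `S`,
then one can choose pairwise distinct vertices `v i j ∉ S` (for `i < j`), each adjacent
to `s i` and `s j` and to no other element of `S`. -/
theorem exists_private_common_neighbors
    {V : Type*} (G : SimpleGraph V)
    (s : Fin 5 → V) (hs : Function.Injective s)
    (hpairs : ∀ i j : Fin 5, i ≠ j →
      21 ≤ Set.encard ((G.neighborSet (s i) ∩ G.neighborSet (s j)) \ Set.range s))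
    (hT : Set.encard {v : V | v ∉ Set.range s ∧
      3 ≤ (Finset.univ.filter fun i : Fin 5 => G.Adj (s i) v).card} ≤ 20) :
    ∃ v : Fin 5 → Fin 5 → V,
      (∀ i j, i < j → v i j ∉ Set.range s ∧ G.Adj (s i) (v i j) ∧ G.Adj (s j) (v i j) ∧
        ∀ k, k ≠ i → k ≠ j → ¬ G.Adj (s k) (v i j)) ∧
      (∀ i j k l, i < j → k < l → (i, j) ≠ (k, l) → v i j ≠ v k l) := by
  have key : ∀ i j : Fin 5, i < j → ∃ v : V, v ∉ Set.range s ∧ G.Adj (s i) v ∧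
      G.Adj (s j) v ∧ ∀ k, k ≠ i → k ≠ j → ¬ G.Adj (s k) v := by
    intro i j hij
    obtain ⟨v, ⟨⟨hi, hj⟩, hvs⟩, hvT⟩ := Set.not_subset.mp fun hsub =>
      absurd ((hpairs i j hij.ne).trans ((Set.encard_le_encard hsub).trans hT)) (by norm_num)
    refine ⟨v, hvs, hi, hj, fun k hki hkj hk => hvT ⟨hvs, ?_⟩⟩
    have hcard : ({i, j, k} : Finset (Fin 5)).card = 3 :=
      Finset.card_eq_three.mpr ⟨i, j, k, hij.ne, hki.symm, hkj.symm, rfl⟩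
    rw [← hcard]
    refine Finset.card_le_card fun x hx => ?_
    simp only [Finset.mem_insert, Finset.mem_singleton] at hx
    rw [Finset.mem_filter]
    rcases hx with rfl | rfl | rfl
    exacts [⟨Finset.mem_univ _, hi⟩, ⟨Finset.mem_univ _, hj⟩, ⟨Finset.mem_univ _, hk⟩]
  obtain ⟨v₀, -⟩ := key 0 1 (by decide)
  have : Nonempty V := ⟨v₀⟩
  choose! v hv using key
  refine ⟨v, hv, fun i j k l hij hkl hne heq => ?_⟩
  obtain ⟨-, -, -, hother⟩ := hv i j hij
  obtain ⟨-, hk, hl, -⟩ := hv k l hkl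
  rw [← heq] at hk hl
  have hk' : k = i ∨ k = j := by
    by_contra! h
    exact hother k h.1 h.2 hk
  have hl' : l = i ∨ l = j := by
    by_contra! h
    exact hother l h.1 h.2 hl
  rcases hk' with rfl | rfl <;> rcases hl' with rfl | rfl
  · exact hkl.ne rfl
  · exact hne rfl
  · exact lt_asymm hij hkl
  · exact hkl.ne rfl
end

section
/- Let G = (V, E) be a simple graph that contains no subgraph isomorphic to K_{3,3} and no subgraph isomorphic to the 1-subdivision of K₅; the latter means: there do not exist five distinct vertices w₁, …, w₅ together with pairwise distinct vertices u_{ij} (1 ≤ i < j ≤ 5), each u_{ij} ∉ {w₁, …, w₅}, such that u_{ij} is adjacent to w_i and to w_j for every i < j. (Both conditions hold for every planar graph.) Then for any set S = {s₁, …, s₅} of five distinct vertices of G there exist indices i ≠ j such that #(N_G(s_i) ∩ N_G(s_j) \ S) ≤ 20. -/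
namespace SimpleGraph

variable {V ι : Type*}

/-- The common neighbors of the vertices `s i`, `i ∈ t`, lying outside the range of `s`. -/
def outerCommonNeighbors (G : SimpleGraph V) (s : ι → V) (t : Finset ι) : Set V :=
  {v | v ∉ Set.range s ∧ ∀ i ∈ t, G.Adj (s i) v}

theorem encard_outerCommonNeighbors_le_two (G : SimpleGraph V)
    (hK33 : ¬ ∃ f : Fin 3 ⊕ Fin 3 → V, Function.Injective f ∧
      ∀ a b, (completeBipartiteGraph (Fin 3) (Fin 3)).Adj a b → G.Adj (f a) (f b))
    {s : ι → V} (hs : Function.Injective s) {t : Finset ι} (ht : t.card = 3) :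
    (G.outerCommonNeighbors s t).encard ≤ 2 := by
  by_contra! h
  have h3 : (3 : ℕ∞) ≤ (G.outerCommonNeighbors s t).encard := Order.add_one_le_of_lt h
  obtain ⟨c, hc, hc3⟩ := Set.exists_subset_encard_eq h3
  have hfin : c.Finite := Set.finite_of_encard_eq_coe hc3
  have hcard : hfin.toFinset.card = 3 := by
    rw [hfin.encard_eq_coe_toFinset_card] at hc3
    exact_mod_cast hc3
  let e := (Finset.equivFinOfCardEq ht).symm
  let g := (Finset.equivFinOfCardEq hcard).symm
  have hg (b : Fin 3) : (g b : V) ∈ G.outerCommonNeighbors s t :=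
    hc (hfin.mem_toFinset.mp (g b).2)
  refine hK33 ⟨Sum.elim (fun a => s (e a)) (fun b => g b), ?_, ?_⟩
  · refine Function.Injective.sumElim (hs.comp (Subtype.val_injective.comp e.injective))
      (Subtype.val_injective.comp g.injective) fun a b hab => (hg b).1 ⟨_, hab⟩
  · rintro (a | a) (b | b) hab
    · simp at hab
    · exact (hg b).2 _ (e a).2
    · exact ((hg a).2 _ (e b).2).symm
    · simp at hab

theorem encard_biUnion_outerCommonNeighbors_le_twenty (G : SimpleGraph V)
    (hK33 : ¬ ∃ f : Fin 3 ⊕ Fin 3 → V, Function.Injective f ∧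
      ∀ a b, (completeBipartiteGraph (Fin 3) (Fin 3)).Adj a b → G.Adj (f a) (f b))
    {s : Fin 5 → V} (hs : Function.Injective s) :
    (⋃ t ∈ Finset.powersetCard 3 (Finset.univ : Finset (Fin 5)),
      G.outerCommonNeighbors s t).encard ≤ 20 := by
  calc
    _ ≤ ∑ t ∈ Finset.powersetCard 3 (Finset.univ : Finset (Fin 5)),
        (G.outerCommonNeighbors s t).encard := Finset.set_encard_biUnion_le _ _
    _ ≤ (Finset.powersetCard 3 (Finset.univ : Finset (Fin 5))).card • (2 : ℕ∞) :=
        Finset.sum_le_card_nsmul _ _ _ fun t ht =>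
          G.encard_outerCommonNeighbors_le_two hK33 hs (Finset.mem_powersetCard.mp ht).2
    _ = 20 := by
        rw [Finset.card_powersetCard, Finset.card_univ, Fintype.card_fin,
          show Nat.choose 5 3 = 10 from rfl]
        norm_num

end SimpleGraph


/-- **Proposition 5.1** (with planarity replaced by the two consequences of planarity
used in its proof). If a simple graph contains no subgraph isomorphic to `K₃,₃` and no
subgraph isomorphic to the 1-subdivision of `K₅`, then among any five distinct vertices
`s 0, …, s 4` there are two, `s i` and `s j`, having at most `20` common neighbors
outside `{s 0, …, s 4}`. -/
theorem exists_pair_common_neighbors_le_twenty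
    {V : Type*} (G : SimpleGraph V)
    (hK33 : ¬ ∃ f : Fin 3 ⊕ Fin 3 → V, Function.Injective f ∧
      ∀ a b, (completeBipartiteGraph (Fin 3) (Fin 3)).Adj a b → G.Adj (f a) (f b))
    (hK5sub : ¬ ∃ (w : Fin 5 → V) (u : Fin 5 → Fin 5 → V), Function.Injective w ∧
      (∀ i j : Fin 5, i < j → u i j ∉ Set.range w ∧
        G.Adj (w i) (u i j) ∧ G.Adj (w j) (u i j)) ∧
      (∀ i j k l : Fin 5, i < j → k < l → (i, j) ≠ (k, l) → u i j ≠ u k l))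
    (s : Fin 5 → V) (hs : Function.Injective s) :
    ∃ i j : Fin 5, i ≠ j ∧
      Set.encard ((G.neighborSet (s i) ∩ G.neighborSet (s j)) \ Set.range s) ≤ 20 := by
  by_contra! h
  have hex (i j : Fin 5) : ∃ v, i < j →
      v ∈ (G.neighborSet (s i) ∩ G.neighborSet (s j)) \ Set.range s ∧
      v ∉ ⋃ t ∈ Finset.powersetCard 3 (Finset.univ : Finset (Fin 5)),
        G.outerCommonNeighbors s t := by
    by_cases hij : i < j
    · have hnot := fun hsub => ((h i j hij.ne).trans_le (Set.encard_le_encard hsub)).not_ge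
        (G.encard_biUnion_outerCommonNeighbors_le_twenty hK33 hs)
      obtain ⟨v, hv⟩ := Set.not_subset.mp hnot
      exact ⟨v, fun _ => hv⟩
    · exact ⟨s i, fun hlt => absurd hlt hij⟩
  choose u hu using hex
  refine hK5sub ⟨s, u, hs, fun i j hij =>
    ⟨(hu i j hij).1.2, (hu i j hij).1.1.1, (hu i j hij).1.1.2⟩, ?_⟩
  intro i j k l hij hkl hne heq
  have hthree : 3 ≤ ({i, j, k, l} : Finset (Fin 5)).card := by
    clear * - hij hkl hne
    decide +revert
  obtain ⟨t, hsub, ht⟩ := Finset.exists_subset_card_eq hthree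
  refine (hu i j hij).2 (Set.mem_biUnion (x := t)
    (Finset.mem_powersetCard.mpr ⟨Finset.subset_univ t, ht⟩) ⟨(hu i j hij).1.2, fun m hm => ?_⟩)
  have hm' := hsub hm
  simp only [Finset.mem_insert, Finset.mem_singleton] at hm'
  rcases hm' with rfl | rfl | rfl | rfl
  · exact (hu _ _ hij).1.1.1
  · exact (hu _ _ hij).1.1.2
  · exact heq ▸ (hu _ _ hkl).1.1.1
  · exact heq ▸ (hu _ _ hkl).1.1.2
end

section
/- Let d ≥ 2 be an integer and let G be a function defined on integers k ≥ m with values in (0,1), strictly decreasing with limit 0, and suppose there are constants c₁ > 0 and c₆ > 0 such that for all sufficiently large k: c₁ᵏ · k^{-2k/(d-1)} ≤ G(k-1) ≤ c₆ᵏ · k^{-2k/(d-1)}. Then, with A_ρ := G_c^{-1}(1/ρ) and I_ρ := ⌊A_ρ + 1/2⌋, one has I_ρ ~ ((d-1)/2) · (log ρ)/(log log ρ) as ρ → ∞. -/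
open Filter Real

/-- `(k + 1) log (k + 1) ~ k log k`. -/
lemma tendsto_succ_mul_log_succ_div :
    Tendsto (fun k : ℕ => (((k + 1 : ℕ) : ℝ) * log ((k + 1 : ℕ) : ℝ)) / ((k : ℝ) * log k))
      atTop (nhds 1) := by
  have hlog : Tendsto (fun k : ℕ => log (k : ℝ)) atTop atTop :=
    tendsto_log_atTop.comp tendsto_natCast_atTop_atTop
  have h₁ : Tendsto (fun k : ℕ => 1 + 1 / (k : ℝ)) atTop (nhds (1 + 0)) :=
    tendsto_const_nhds.add tendsto_one_div_atTop_nhds_zero_nat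
  have h₂ : Tendsto (fun k : ℕ => 1 + (log ((k : ℝ) + 1) - log k) / log k) atTop (nhds (1 + 0)) :=
    tendsto_const_nhds.add (tendsto_log_nat_add_one_sub_log.div_atTop hlog)
  have h := h₁.mul h₂
  simp only [add_zero, mul_one] at h
  refine h.congr' ?_
  filter_upwards [eventually_gt_atTop 0, hlog.eventually_gt_atTop 0] with k hk hk'
  have : (0 : ℝ) < k := by exact_mod_cast hk
  push_cast
  field_simp
  ring

/-- If `L ~ a x log x` with `a > 0` and `x → ∞`, then `L / log L ~ a x`. -/
lemma tendsto_div_log_div_of_tendsto_div_mul_log {α : Type*} {l : Filter α} {x L : α → ℝ} {a : ℝ}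
    (ha : 0 < a) (hx : Tendsto x l atTop)
    (hL : Tendsto (fun t => L t / (x t * log (x t))) l (nhds a)) :
    Tendsto (fun t => L t / log (L t) / x t) l (nhds a) := by
  have hlogx : Tendsto (fun t => log (x t)) l atTop := tendsto_log_atTop.comp hx
  have hloglog : Tendsto (fun t => log (log (x t)) / log (x t)) l (nhds 0) :=
    isLittleO_log_id_atTop.tendsto_div_nhds_zero.comp hlogx
  have hratio : Tendsto (fun t => log (L t) / log (x t)) l (nhds 1) := by
    have h := (((hL.log ha.ne').div_atTop hlogx).add_const 1).add hloglog
    simp only [zero_add, add_zero] at h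
    refine h.congr' ?_
    filter_upwards [hx.eventually_gt_atTop 0, hlogx.eventually_gt_atTop 0,
      hL.eventually_const_lt ha] with t hx0 hl0 hq
    have hxl : 0 < x t * log (x t) := mul_pos hx0 hl0
    have hL0 : L t ≠ 0 := by
      rintro h0
      simp [h0] at hq
    rw [log_div hL0 hxl.ne', log_mul hx0.ne' hl0.ne']
    field_simp
    ring
  have h := hL.div hratio one_ne_zero
  rw [div_one] at h
  refine h.congr' ?_
  filter_upwards [hx.eventually_gt_atTop 0, hlogx.eventually_gt_atTop 0,
    hratio.eventually_const_lt one_pos] with t hx0 hl0 hq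
  have hlL : log (L t) ≠ 0 := by
    rintro h0
    simp [h0] at hq
  simp only [Pi.div_apply]
  field_simp

/-- Two-sided bounds `c₁ᵏ k^{-ak} ≤ G (k - 1) ≤ c₂ᵏ k^{-ak}` give `-log (G (k - 1)) ~ a k log k`. -/
lemma tendsto_neg_log_pred_div {G : ℕ → ℝ} {c₁ c₂ : ℝ} {a : ℝ} {e : ℕ → ℝ}
    (he : ∀ k, e k = -(a * k)) (hc₁ : 0 < c₁) (hc₂ : 0 < c₂)
    (hbound : ∀ᶠ k : ℕ in atTop,
      c₁ ^ k * (k : ℝ) ^ e k ≤ G (k - 1) ∧ G (k - 1) ≤ c₂ ^ k * (k : ℝ) ^ e k) :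
    Tendsto (fun k : ℕ => -log (G (k - 1)) / (k * log k)) atTop (nhds a) := by
  have hlog : Tendsto (fun k : ℕ => log (k : ℝ)) atTop atTop :=
    tendsto_log_atTop.comp tendsto_natCast_atTop_atTop
  have hlim (c : ℝ) : Tendsto (fun k : ℕ => a - log c / log (k : ℝ)) atTop (nhds a) := by
    simpa using (tendsto_const_nhds (x := a)).sub
      ((tendsto_const_nhds (x := log c)).div_atTop hlog)
  have hval {c : ℝ} (hc : 0 < c) {k : ℕ} (hk : 0 < (k : ℝ)) :
      log (c ^ k * (k : ℝ) ^ e k) = k * log c - a * k * log k := by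
    rw [log_mul (by positivity) (by positivity), log_pow, log_rpow hk, he]
    ring
  refine tendsto_of_tendsto_of_tendsto_of_le_of_le' (hlim c₂) (hlim c₁) ?_ ?_
  all_goals
    filter_upwards [hbound, eventually_gt_atTop 0, hlog.eventually_gt_atTop 0] with k hb hk hl
    have hk : (0 : ℝ) < k := by exact_mod_cast hk
    have h₁ : 0 < c₁ ^ k * (k : ℝ) ^ e k := by positivity
    have hlo := log_le_log h₁ hb.1
    have hup := log_le_log (h₁.trans_le hb.1) hb.2
    rw [hval hc₁ hk] at hlo
    rw [hval hc₂ hk] at hup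
  · rw [le_div_iff₀ (by positivity)]
    have : (a - log c₂ / log k) * (k * log k) = a * k * log k - k * log c₂ := by
      field_simp
    linarith
  · rw [div_le_iff₀ (by positivity)]
    have : (a - log c₁ / log k) * (k * log k) = a * k * log k - k * log c₁ := by
      field_simp
    linarith

/-- **Lemma 3.1.** Let `G` be the tail function of a discrete distribution satisfying
`c₁ᵏ k^{-2k/(d-1)} ≤ G (k-1) ≤ c₆ᵏ k^{-2k/(d-1)}` for large `k`, let `G_c` be its
continuous, strictly decreasing, log-linear interpolation, let `A ρ = G_c⁻¹ (1/ρ)` and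
`I ρ = ⌊A ρ + 1/2⌋`.  Then `I ρ ~ ((d-1)/2) · log ρ / log log ρ` as `ρ → ∞`. -/
theorem I_rho_asymptotics
    (d : ℕ) (hd : 2 ≤ d) (m : ℕ) (G : ℕ → ℝ)
    (hG01 : ∀ k, m ≤ k → G k ∈ Set.Ioo (0 : ℝ) 1)
    (hGdec : ∀ k, m ≤ k → G (k + 1) < G k)
    (hGlim : Tendsto G atTop (nhds 0))
    (c₁ c₆ : ℝ) (hc₁ : 0 < c₁) (hc₆ : 0 < c₆)
    (hbound : ∀ᶠ k : ℕ in atTop,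
      c₁ ^ k * (k : ℝ) ^ (-(2 * (k : ℝ)) / ((d : ℝ) - 1)) ≤ G (k - 1) ∧
      G (k - 1) ≤ c₆ ^ k * (k : ℝ) ^ (-(2 * (k : ℝ)) / ((d : ℝ) - 1)))
    -- `Gc` is the continuous extension `G_c(x) = exp(-h_c(x))` of `G`,
    -- where `h_c` is the linear interpolation of `h(k) = -log G(k)`:
    (Gc : ℝ → ℝ)
    (hGc : ∀ x : ℝ, (m : ℝ) ≤ x → Gc x =
      Real.exp (Real.log (G ⌊x⌋₊) +
        (x - (⌊x⌋₊ : ℝ)) * (Real.log (G (⌊x⌋₊ + 1)) - Real.log (G ⌊x⌋₊))))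
    -- `A ρ = G_c⁻¹(1/ρ)`, characterized by `Gc (A ρ) = 1/ρ`:
    (A : ℝ → ℝ)
    (hA : ∀ᶠ ρ : ℝ in atTop, (m : ℝ) ≤ A ρ ∧ Gc (A ρ) = 1 / ρ) :
    Tendsto (fun ρ : ℝ => (⌊A ρ + 1 / 2⌋₊ : ℝ) /
      ((((d : ℝ) - 1) / 2) * (Real.log ρ / Real.log (Real.log ρ)))) atTop (nhds 1) := by
  have hd' : (0 : ℝ) < (d : ℝ) - 1 := by
    have : (2 : ℝ) ≤ d := by exact_mod_cast hd
    linarith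
  set a : ℝ := 2 / ((d : ℝ) - 1) with ha
  have ha0 : 0 < a := by positivity
  have hpred := tendsto_neg_log_pred_div (a := a) (fun k => by rw [ha]; ring) hc₁ hc₆ hbound
  have hsucc : Tendsto (fun k : ℕ => -log (G k) / (k * log k)) atTop (nhds a) := by
    have h := ((tendsto_add_atTop_iff_nat 1).2 hpred).mul tendsto_succ_mul_log_succ_div
    rw [mul_one] at h
    refine h.congr' ?_
    filter_upwards [eventually_gt_atTop 0] with k hk
    have h₁ : (0 : ℝ) < ((k + 1 : ℕ) : ℝ) := by positivity
    have h₂ : 0 < log ((k + 1 : ℕ) : ℝ) := log_pos (by exact_mod_cast Nat.lt_add_of_pos_left hk)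
    rw [Nat.add_sub_cancel, div_mul_div_cancel₀ (mul_pos h₁ h₂).ne']
  have hsucc' : Tendsto (fun k : ℕ => -log (G (k + 1)) / (k * log k)) atTop (nhds a) := by
    have h := ((tendsto_add_atTop_iff_nat 1).2 hsucc).mul tendsto_succ_mul_log_succ_div
    rw [mul_one] at h
    refine h.congr' ?_
    filter_upwards [eventually_gt_atTop 0] with k hk
    have h₁ : (0 : ℝ) < ((k + 1 : ℕ) : ℝ) := by positivity
    have h₂ : 0 < log ((k + 1 : ℕ) : ℝ) := log_pos (by exact_mod_cast Nat.lt_add_of_pos_left hk)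
    rw [div_mul_div_cancel₀ (mul_pos h₁ h₂).ne']
  have hanti : AntitoneOn G (Set.Ici m) :=
    antitoneOn_of_succ_le Set.ordConnected_Ici fun k _ hk _ => (hGdec k hk).le
  have hlogρ : ∀ᶠ ρ : ℝ in atTop, m ≤ ⌊A ρ⌋₊ ∧
      -log (G ⌊A ρ⌋₊) ≤ log ρ ∧ log ρ ≤ -log (G (⌊A ρ⌋₊ + 1)) := by
    filter_upwards [hA] with ρ hρ
    obtain ⟨hm, hρ⟩ := hρ
    have hfl : m ≤ ⌊A ρ⌋₊ := Nat.le_floor hm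
    rw [hGc _ hm] at hρ
    have hA0 : 0 ≤ A ρ := (Nat.cast_nonneg m).trans hm
    have hρ' := congrArg log hρ
    rw [log_exp, one_div, log_inv] at hρ'
    have hle := Nat.floor_le hA0
    have hlt := Nat.lt_floor_add_one (A ρ)
    have hlogle : log (G (⌊A ρ⌋₊ + 1)) ≤ log (G ⌊A ρ⌋₊) :=
      log_le_log (hG01 _ (hfl.trans (Nat.le_succ _))).1 (hGdec _ hfl).le
    refine ⟨hfl, ?_, ?_⟩ <;> nlinarith
  have hn : Tendsto (fun ρ => ⌊A ρ⌋₊) atTop atTop := by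
    refine tendsto_atTop.2 fun N => ?_
    filter_upwards [hlogρ, tendsto_log_atTop.eventually_gt_atTop (-log (G (m + N)))]
      with ρ hρ hbig
    by_contra! hlt
    have hG : G (m + N) ≤ G (⌊A ρ⌋₊ + 1) :=
      hanti (Set.mem_Ici.2 (by omega)) (Set.mem_Ici.2 (by omega)) (by omega)
    have := log_le_log (hG01 (m + N) (by omega)).1 hG
    linarith
  have hnR : Tendsto (fun ρ => (⌊A ρ⌋₊ : ℝ)) atTop atTop := tendsto_natCast_atTop_atTop.comp hn
  have hL : Tendsto (fun ρ => log ρ / ((⌊A ρ⌋₊ : ℝ) * log (⌊A ρ⌋₊ : ℝ))) atTop (nhds a) := by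
    refine tendsto_of_tendsto_of_tendsto_of_le_of_le' (hsucc.comp hn) (hsucc'.comp hn) ?_ ?_
    all_goals
      filter_upwards [hlogρ] with ρ hρ
      simp only [Function.comp_apply]
      have : 0 ≤ log (⌊A ρ⌋₊ : ℝ) := log_natCast_nonneg _
      gcongr
    · exact hρ.2.1
    · exact hρ.2.2
  have hLL := tendsto_div_log_div_of_tendsto_div_mul_log ha0 hnR hL
  have hI : Tendsto (fun ρ => (⌊A ρ + 1 / 2⌋₊ : ℝ) / (⌊A ρ⌋₊ : ℝ)) atTop (nhds 1) := by
    have hup : Tendsto (fun ρ => 1 + 1 / (⌊A ρ⌋₊ : ℝ)) atTop (nhds 1) := by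
      simpa using (tendsto_const_nhds (x := (1 : ℝ))).add
        ((tendsto_const_nhds (x := (1 : ℝ))).div_atTop hnR)
    refine tendsto_of_tendsto_of_tendsto_of_le_of_le' tendsto_const_nhds hup ?_ ?_
    all_goals
      filter_upwards [hA, hnR.eventually_gt_atTop 0] with ρ hρ hpos
    · rw [le_div_iff₀ hpos, one_mul]
      exact_mod_cast Nat.floor_mono (by linarith)
    · rw [div_le_iff₀ hpos, add_mul, one_div_mul_cancel hpos.ne', one_mul]
      have hA0 : 0 ≤ A ρ := (Nat.cast_nonneg m).trans hρ.1
      rw [← Nat.cast_add_one, ← Nat.floor_add_one hA0]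
      exact_mod_cast Nat.floor_mono (by linarith)
  have h := hI.mul ((tendsto_const_nhds (x := a)).div hLL ha0.ne')
  rw [div_self ha0.ne', mul_one] at h
  refine h.congr' ?_
  filter_upwards [hnR.eventually_gt_atTop 0, hLL.eventually_const_lt ha0] with ρ hpos hq
  have hq' : log ρ / log (log ρ) ≠ 0 := by
    rintro h0
    simp [h0] at hq
  simp only [Pi.div_apply, ha]
  generalize log ρ / log (log ρ) = q at hq'
  field_simp
end

section
/- Let G be a function defined on integers k ≥ m with values in (0,1), strictly decreasing to 0, such that G(k+1)/G(k) → 0 as k → ∞. Then the continuous extension G_c satisfies: for every fixed y > 0, G_c(x + y)/G_c(x) → 0 as x → ∞. -/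
open Filter Real

/-- The piecewise linear interpolation of a sequence. -/
noncomputable def linearInterp (a : ℕ → ℝ) (x : ℝ) : ℝ :=
  a ⌊x⌋₊ + (x - (⌊x⌋₊ : ℝ)) * (a (⌊x⌋₊ + 1) - a ⌊x⌋₊)

/-- If all increments of `a` from `N` on are at most `c`, then so are all slopes of its
piecewise linear interpolation on `[N, ∞)`. -/
theorem linearInterp_sub_le {a : ℕ → ℝ} {c : ℝ} {N : ℕ}
    (ha : ∀ k, N ≤ k → a (k + 1) - a k ≤ c) {x y : ℝ} (hx : (N : ℝ) ≤ x) (hxy : x ≤ y) :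
    linearInterp a y - linearInterp a x ≤ c * (y - x) := by
  have hx0 : 0 ≤ x := (Nat.cast_nonneg N).trans hx
  have hN : N ≤ ⌊x⌋₊ := Nat.le_floor hx
  have hle : ⌊x⌋₊ ≤ ⌊y⌋₊ := Nat.floor_mono hxy
  have hx1 := Nat.lt_floor_add_one x
  have hy1 := Nat.floor_le (hx0.trans hxy)
  unfold linearInterp
  generalize ⌊x⌋₊ = n at *
  generalize ⌊y⌋₊ = p at *
  have hn := ha n hN
  have hp := ha p (hN.trans hle)
  rcases hle.eq_or_lt with rfl | hlt
  · nlinarith [mul_le_mul_of_nonneg_left hn (sub_nonneg.2 hxy)]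
  · have key : ∀ q, n + 1 ≤ q → a q - a (n + 1) ≤ c * ((q : ℝ) - (n + 1)) := by
      intro q hq
      induction q, hq using Nat.le_induction with
      | base => simp
      | succ q hq ih =>
        have := ha q (by omega)
        push_cast
        linarith
    have hnp := key p hlt
    have h1 := mul_le_mul_of_nonneg_left hn (sub_nonneg.2 hx1.le)
    have h2 := mul_le_mul_of_nonneg_left hp (sub_nonneg.2 hy1)
    linarith

/-- If the increments of `a` tend to `-∞`, then so do the increments of its piecewise linear
interpolation over any fixed positive step. -/
theorem tendsto_linearInterp_add_sub_atBot {a : ℕ → ℝ}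
    (ha : Tendsto (fun k => a (k + 1) - a k) atTop atBot) {y : ℝ} (hy : 0 < y) :
    Tendsto (fun x => linearInterp a (x + y) - linearInterp a x) atTop atBot := by
  refine tendsto_atBot.2 fun b => ?_
  obtain ⟨N, hN⟩ := eventually_atTop.1 (tendsto_atBot.1 ha (b / y))
  filter_upwards [eventually_ge_atTop (N : ℝ)] with x hx
  have h := linearInterp_sub_le hN hx (le_add_of_nonneg_right hy.le : x ≤ x + y)
  rwa [add_sub_cancel_left, div_mul_cancel₀ _ hy.ne'] at h

/-- Equation (eq:rateG): if the discrete tail function `G` satisfies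
`G(k+1)/G(k) → 0`, then its continuous log-linear extension `G_c` satisfies
`G_c(x+y)/G_c(x) → 0` as `x → ∞`, for every fixed `y > 0`. -/
theorem Gc_ratio_tendsto_zero
    (m : ℕ) (G : ℕ → ℝ)
    (hG01 : ∀ k, m ≤ k → G k ∈ Set.Ioo (0 : ℝ) 1)
    (hGdec : ∀ k, m ≤ k → G (k + 1) < G k)
    (hGlim : Tendsto G atTop (nhds 0))
    (hratio : Tendsto (fun k : ℕ => G (k + 1) / G k) atTop (nhds 0))
    (Gc : ℝ → ℝ)
    (hGc : ∀ x : ℝ, (m : ℝ) ≤ x → Gc x =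
      Real.exp (Real.log (G ⌊x⌋₊) +
        (x - (⌊x⌋₊ : ℝ)) * (Real.log (G (⌊x⌋₊ + 1)) - Real.log (G ⌊x⌋₊)))) :
    ∀ y : ℝ, 0 < y →
      Tendsto (fun x : ℝ => Gc (x + y) / Gc x) atTop (nhds 0) := by
  intro y hy
  have hpos : ∀ k, m ≤ k → 0 < G k := fun k hk => (hG01 k hk).1
  have hlog : Tendsto (fun k => Real.log (G (k + 1)) - Real.log (G k)) atTop atBot := by
    have hwithin : Tendsto (fun k => G (k + 1) / G k) atTop (nhdsWithin 0 (Set.Ioi 0)) := by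
      refine tendsto_nhdsWithin_iff.2 ⟨hratio, ?_⟩
      filter_upwards [eventually_ge_atTop m] with k hk
      exact div_pos (hpos _ (by omega)) (hpos k hk)
    refine (Real.tendsto_log_nhdsGT_zero.comp hwithin).congr' ?_
    filter_upwards [eventually_ge_atTop m] with k hk
    exact Real.log_div (hpos _ (by omega)).ne' (hpos k hk).ne'
  refine (Real.tendsto_exp_atBot.comp (tendsto_linearInterp_add_sub_atBot
    (a := fun k => Real.log (G k)) hlog hy)).congr' ?_
  filter_upwards [eventually_ge_atTop (m : ℝ)] with x hx
  rw [hGc x hx, hGc (x + y) (by linarith), ← Real.exp_sub]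
  rfl
end

section
/- Let G be a function defined on integers k ≥ m with values in (0,1), strictly decreasing to 0, such that G(k+1)/G(k) → 0 as k → ∞. With A_ρ := G_c^{-1}(1/ρ) and I_ρ := ⌊A_ρ + 1/2⌋, one has: (i) ρ · G_c(I_ρ + 1) → 0 as ρ → ∞, and (ii) ρ · G_c(I_ρ - 1) → ∞ as ρ → ∞. -/
open Filter Real

/-- If consecutive ratios of an eventually positive sequence tend to `0`, then the decrements of
its logarithm tend to infinity. -/
lemma tendsto_log_sub_log_succ_atTop {G : ℕ → ℝ} (hpos : ∀ᶠ k in atTop, 0 < G k)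
    (hratio : Tendsto (fun k : ℕ => G (k + 1) / G k) atTop (nhds 0)) :
    Tendsto (fun k : ℕ => log (G k) - log (G (k + 1))) atTop atTop := by
  have hpos' : ∀ᶠ k in atTop, 0 < G (k + 1) := (tendsto_add_atTop_nat 1).eventually hpos
  have hr : Tendsto (fun k : ℕ => G (k + 1) / G k) atTop (nhdsWithin 0 (Set.Ioi 0)) := by
    refine tendsto_nhdsWithin_iff.2 ⟨hratio, ?_⟩
    filter_upwards [hpos, hpos'] with k h h'
    exact div_pos h' h
  refine (tendsto_neg_atBot_atTop.comp (Real.tendsto_log_nhdsGT_zero.comp hr)).congr' ?_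
  filter_upwards [hpos, hpos'] with k h h'
  simp [Real.log_div h'.ne' h.ne']

/-- Along any `A` at which the log-linear interpolation of a positive decreasing sequence equals
`1 / ρ`, the integer part of `A ρ` tends to infinity with `ρ`. -/
lemma tendsto_floor_atTop_of_interpolation_eq {m : ℕ} {G : ℕ → ℝ}
    (hpos : ∀ k, m ≤ k → 0 < G k) (hGdec : ∀ k, m ≤ k → G (k + 1) < G k)
    {A : ℝ → ℝ}
    (hA : ∀ᶠ ρ : ℝ in atTop, (m : ℝ) ≤ A ρ ∧
      exp (log (G ⌊A ρ⌋₊) +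
        (A ρ - (⌊A ρ⌋₊ : ℝ)) * (log (G (⌊A ρ⌋₊ + 1)) - log (G ⌊A ρ⌋₊))) = 1 / ρ) :
    Tendsto (fun ρ => ⌊A ρ⌋₊) atTop atTop := by
  refine tendsto_atTop.2 fun N => ?_
  have hN : 0 < G (max m N) := hpos _ (le_max_left _ _)
  filter_upwards [hA, eventually_gt_atTop (1 / G (max m N)), eventually_gt_atTop 0]
    with ρ ⟨hm, hρ⟩ hlarge hρ0
  by_contra! hlt
  have hmn : m ≤ ⌊A ρ⌋₊ := Nat.le_floor hm
  have hanti : AntitoneOn G (Set.Ici m) :=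
    antitoneOn_of_succ_le Set.ordConnected_Ici fun k _ hk _ => (hGdec k hk).le
  have h1 : G (max m N) ≤ G (⌊A ρ⌋₊ + 1) :=
    hanti (Set.mem_Ici.2 (by omega)) (Set.mem_Ici.2 (le_max_left _ _)) (by omega)
  have h2 : log (G (⌊A ρ⌋₊ + 1)) < log (G ⌊A ρ⌋₊) :=
    log_lt_log (hpos _ (by omega)) (hGdec _ hmn)
  have h3 : log (G (⌊A ρ⌋₊ + 1)) ≤ log (1 / ρ) := by
    rw [← hρ, log_exp]
    nlinarith [Nat.lt_floor_add_one (A ρ)]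
  have h4 : G (⌊A ρ⌋₊ + 1) ≤ 1 / ρ :=
    (log_le_log_iff (hpos _ (by omega)) (by positivity)).1 h3
  have h5 : 1 / ρ < G (max m N) := (one_div_lt hN hρ0).1 hlarge
  linarith

/-- **Lemma 3.2 (i) and (ii) with `l = 0`**, in abstract form: with
`A ρ = G_c⁻¹(1/ρ)` and `I ρ = ⌊A ρ + 1/2⌋`, one has `ρ · G_c(I_ρ + 1) → 0` and
`ρ · G_c(I_ρ - 1) → ∞` as `ρ → ∞`. -/
theorem rho_Gc_I_tendsto
    (m : ℕ) (G : ℕ → ℝ)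
    (hG01 : ∀ k, m ≤ k → G k ∈ Set.Ioo (0 : ℝ) 1)
    (hGdec : ∀ k, m ≤ k → G (k + 1) < G k)
    (hGlim : Tendsto G atTop (nhds 0))
    (hratio : Tendsto (fun k : ℕ => G (k + 1) / G k) atTop (nhds 0))
    (Gc : ℝ → ℝ)
    (hGc : ∀ x : ℝ, (m : ℝ) ≤ x → Gc x =
      Real.exp (Real.log (G ⌊x⌋₊) +
        (x - (⌊x⌋₊ : ℝ)) * (Real.log (G (⌊x⌋₊ + 1)) - Real.log (G ⌊x⌋₊))))
    (A : ℝ → ℝ)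
    (hA : ∀ᶠ ρ : ℝ in atTop, (m : ℝ) ≤ A ρ ∧ Gc (A ρ) = 1 / ρ) :
    Tendsto (fun ρ : ℝ => ρ * Gc ((⌊A ρ + 1 / 2⌋₊ : ℝ) + 1)) atTop (nhds 0) ∧
    Tendsto (fun ρ : ℝ => ρ * Gc ((⌊A ρ + 1 / 2⌋₊ : ℝ) - 1)) atTop atTop := by
  have hpos : ∀ k, m ≤ k → 0 < G k := fun k hk => (hG01 k hk).1
  have hd := tendsto_log_sub_log_succ_atTop ((eventually_ge_atTop m).mono hpos) hratio
  have hfloor : Tendsto (fun ρ => ⌊A ρ⌋₊) atTop atTop := by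
    refine tendsto_floor_atTop_of_interpolation_eq hpos hGdec ?_
    filter_upwards [hA] with ρ ⟨hm, hρ⟩
    exact ⟨hm, by rw [← hGc _ hm, hρ]⟩
  have hnat : ∀ k : ℕ, m ≤ k → Gc k = exp (log (G k)) := fun k hk => by
    rw [hGc k (by exact_mod_cast hk)]
    simp
  have hmul : ∀ᶠ ρ : ℝ in atTop, ∀ k : ℕ, m ≤ k → ρ * Gc k =
      exp (log (G k) - log (G ⌊A ρ⌋₊) +
        (A ρ - (⌊A ρ⌋₊ : ℝ)) * (log (G ⌊A ρ⌋₊) - log (G (⌊A ρ⌋₊ + 1)))) := by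
    filter_upwards [hA] with ρ ⟨hm, hρ⟩ k hk
    have hρ' : ρ = (Gc (A ρ))⁻¹ := by rw [hρ, one_div, inv_inv]
    nth_rw 1 [hρ']
    rw [hnat k hk, hGc _ hm, ← exp_neg, ← exp_add]
    ring_nf
  have hlarge : ∀ K : ℝ, ∀ᶠ ρ : ℝ in atTop, m + 1 ≤ ⌊A ρ⌋₊ ∧ ∀ k, ⌊A ρ⌋₊ ≤ k + 1 →
      K ≤ log (G k) - log (G (k + 1)) := fun K => by
    obtain ⟨N, hN⟩ := eventually_atTop.1 (hd.eventually_ge_atTop K)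
    filter_upwards [hfloor.eventually_ge_atTop (max (m + 1) (N + 1))] with ρ hρ
    exact ⟨by omega, fun k hk => hN k (by omega)⟩
  have hround : ∀ᶠ ρ : ℝ in atTop,
      (⌊A ρ + 1 / 2⌋₊ = ⌊A ρ⌋₊ ∧ 0 ≤ A ρ - ⌊A ρ⌋₊ ∧ A ρ - ⌊A ρ⌋₊ ≤ 1 / 2) ∨
      (⌊A ρ + 1 / 2⌋₊ = ⌊A ρ⌋₊ + 1 ∧ 1 / 2 ≤ A ρ - ⌊A ρ⌋₊ ∧ A ρ - ⌊A ρ⌋₊ ≤ 1) := by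
    filter_upwards [hA] with ρ ⟨hm, _⟩
    have h0 : 0 ≤ A ρ := (Nat.cast_nonneg m).trans hm
    have h1 := Nat.floor_le h0
    have h2 := Nat.lt_floor_add_one (A ρ)
    rcases lt_or_ge (A ρ - ⌊A ρ⌋₊) (1 / 2) with h | h
    · refine .inl ⟨(Nat.floor_eq_iff (by positivity)).2 ⟨?_, ?_⟩, ?_, h.le⟩ <;> linarith
    · refine .inr ⟨(Nat.floor_eq_iff (by positivity)).2 ⟨?_, ?_⟩, h, ?_⟩ <;> push_cast <;> linarith
  constructor
  · have hE : Tendsto (fun ρ => log (G (⌊A ρ + 1 / 2⌋₊ + 1)) - log (G ⌊A ρ⌋₊) +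
        (A ρ - (⌊A ρ⌋₊ : ℝ)) * (log (G ⌊A ρ⌋₊) - log (G (⌊A ρ⌋₊ + 1)))) atTop atBot := by
      refine tendsto_atBot.2 fun K => ?_
      filter_upwards [hlarge (2 * |K|), hround] with ρ ⟨_, hK⟩ hr
      have hK0 := hK ⌊A ρ⌋₊ (by omega)
      have hK1 := hK (⌊A ρ⌋₊ + 1) (by omega)
      have := neg_abs_le K
      have := abs_nonneg K
      rcases hr with ⟨hI, _, _⟩ | ⟨hI, _, _⟩ <;> rw [hI] <;> nlinarith
    refine (tendsto_exp_atBot.comp hE).congr' ?_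
    filter_upwards [hmul, hlarge 0, hround] with ρ hρ ⟨hm, _⟩ hr
    rw [Function.comp_apply, ← hρ _ (by omega)]
    push_cast
    rfl
  · have hE : Tendsto (fun ρ => log (G (⌊A ρ + 1 / 2⌋₊ - 1)) - log (G ⌊A ρ⌋₊) +
        (A ρ - (⌊A ρ⌋₊ : ℝ)) * (log (G ⌊A ρ⌋₊) - log (G (⌊A ρ⌋₊ + 1)))) atTop atTop := by
      refine tendsto_atTop.2 fun K => ?_
      filter_upwards [hlarge (2 * |K|), hround] with ρ ⟨hm, hK⟩ hr
      have hK0 := hK ⌊A ρ⌋₊ (by omega)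
      have hK1 := hK (⌊A ρ⌋₊ - 1) (by omega)
      rw [Nat.sub_add_cancel (by omega)] at hK1
      have := le_abs_self K
      have := abs_nonneg K
      rcases hr with ⟨hI, _, _⟩ | ⟨hI, _, _⟩ <;> rw [hI]
      · nlinarith
      · rw [Nat.add_sub_cancel]
        nlinarith
    refine (tendsto_exp_atTop.comp hE).congr' ?_
    filter_upwards [hmul, hlarge 0, hround] with ρ hρ ⟨hm, _⟩ hr
    rw [Function.comp_apply, ← hρ _ (by omega), Nat.cast_sub (by omega), Nat.cast_one]
end

section
/- Let d ≥ 2 be an integer and let p : ℕ → (0,∞) be a probability mass function (Σ_k p(k) = 1 and p(k) > 0 for k ≥ m). Assume: (a) there is c₂ > 0 with p(k) ≤ c₂ · k^{-2/(d-1)} · p(k-1) for all sufficiently large k, and (b) there is c₁ > 0 with p(k) ≥ c₁ᵏ · k^{-2k/(d-1)} for all sufficiently large k. Let G(k) := Σ_{j > k} p(j) and define I_ρ := ⌊G_c^{-1}(1/ρ) + 1/2⌋. Then for every integer l ≥ 0, ((log log ρ)/(log ρ))^{2l/(d-1)} · ρ · Σ_{j ≥ I_ρ - l} p(j) → ∞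 as ρ → ∞. -/
open Filter Real

theorem tsum_nat_shift_pos {p : ℕ → ℝ} {m : ℕ} (hp : Summable p) (hnn : ∀ k, 0 ≤ p k)
    (hpos : ∀ k, m ≤ k → 0 < p k) (n : ℕ) : 0 < ∑' j : ℕ, p (n + j) :=
  (hp.comp_injective (add_right_injective n)).tsum_pos (fun _ => hnn _) m (hpos _ (Nat.le_add_left m n))

theorem le_tsum_nat_shift {p : ℕ → ℝ} (hp : Summable p) (hnn : ∀ k, 0 ≤ p k) (n : ℕ) :
    p n ≤ ∑' j : ℕ, p (n + j) := by
  simpa using (hp.comp_injective (add_right_injective n)).le_tsum 0 fun j _ => hnn (n + j)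

theorem tsum_nat_shift_succ_le {p : ℕ → ℝ} (hp : Summable p) (hnn : ∀ k, 0 ≤ p k) (n : ℕ) :
    ∑' j : ℕ, p (n + 1 + j) ≤ ∑' j : ℕ, p (n + j) := by
  have hs := hp.comp_injective (add_right_injective n)
  have h := hs.tsum_eq_zero_add
  simp only [Function.comp_def] at h
  rw [h]
  have : ∀ j, n + 1 + j = n + (j + 1) := fun j => by omega
  simp only [this]
  linarith [hnn (n + 0)]

/-- A one-step bound `p k ≤ c k^{-a} p (k - 1)` passes to the logarithms of the tails. -/
theorem eventually_log_tail_succ_add_le {p : ℕ → ℝ} {m : ℕ} {a c : ℝ} (hp : Summable p)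
    (hnn : ∀ k, 0 ≤ p k) (hpos : ∀ k, m ≤ k → 0 < p k) (ha : 0 < a) (hc : 0 < c)
    (hrec : ∀ᶠ k : ℕ in atTop, p k ≤ c * (k : ℝ) ^ (-a) * p (k - 1)) :
    ∀ᶠ k : ℕ in atTop, log (∑' j : ℕ, p (k + 1 + j)) + (a * log k - log c) ≤
      log (∑' j : ℕ, p (k + j)) := by
  obtain ⟨K, hK⟩ := eventually_atTop.1 hrec
  filter_upwards [eventually_ge_atTop K, eventually_ge_atTop 1] with k hk hk1
  have hk0 : (0 : ℝ) < k := by exact_mod_cast hk1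
  have hle : ∑' j : ℕ, p (k + 1 + j) ≤ c * (k : ℝ) ^ (-a) * ∑' j : ℕ, p (k + j) := by
    rw [← tsum_mul_left]
    refine Summable.tsum_le_tsum (fun j => ?_) (hp.comp_injective (add_right_injective (k + 1)))
      ((hp.comp_injective (add_right_injective k)).mul_left _)
    have h := hK (k + 1 + j) (by omega)
    rw [show k + 1 + j - 1 = k + j by omega] at h
    refine h.trans ?_
    have hmono : ((k + 1 + j : ℕ) : ℝ) ^ (-a) ≤ (k : ℝ) ^ (-a) :=
      rpow_le_rpow_of_nonpos hk0 (by push_cast; linarith [(Nat.cast_nonneg j : (0 : ℝ) ≤ j)])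
        (by linarith)
    have := hnn (k + j)
    gcongr
  have hS := tsum_nat_shift_pos hp hnn hpos k
  have hlog := log_le_log (tsum_nat_shift_pos hp hnn hpos (k + 1)) hle
  rw [log_mul (by positivity) hS.ne', log_mul hc.ne' (by positivity), log_rpow hk0] at hlog
  linarith

/-- Iterated form of a decrement bound: `l` steps lower the value by at least `l * β`. -/
theorem add_mul_le_of_succ_add_le {g : ℕ → ℝ} {β : ℝ} {n : ℕ}
    (h : ∀ k, n ≤ k → g (k + 1) + β ≤ g k) (l : ℕ) : g (n + l) + l * β ≤ g n := by
  induction l with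
  | zero => simp
  | succ l ih =>
    have := h (n + l) (by omega)
    push_cast
    rw [← add_assoc]
    linarith

/-- The key bound at the rounded index: `g` is the log-tail, and `x = n + θ` is the point at
which the linear interpolation of `k ↦ g (k + 1)` takes the value `-r`. -/
theorem half_step_le_add_log_tail {g : ℕ → ℝ} {β x : ℝ} {l : ℕ} (hx : 0 ≤ x) (hβ : 0 ≤ β)
    (hl : l ≤ ⌊x⌋₊) (h : ∀ k, ⌊x⌋₊ - l ≤ k → g (k + 1) + β ≤ g k) :
    (l + 1 / 2 : ℝ) * β ≤
      -(g (⌊x⌋₊ + 1) + (x - ⌊x⌋₊) * (g (⌊x⌋₊ + 2) - g (⌊x⌋₊ + 1))) + g (⌊x + 1 / 2⌋₊ - l) := by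
  have hfl := Nat.floor_le hx
  have hlt := Nat.lt_floor_add_one x
  set n := ⌊x⌋₊
  have hstep : g (n + 2) + β ≤ g (n + 1) := h (n + 1) (by omega)
  rcases lt_or_ge (x - n) (1 / 2) with hθ | hθ
  · have hI : ⌊x + 1 / 2⌋₊ = n := by
      rw [Nat.floor_eq_iff (by positivity)]
      constructor <;> linarith
    have hit := add_mul_le_of_succ_add_le (n := n - l) h (l + 1)
    rw [show n - l + (l + 1) = n + 1 by omega] at hit
    rw [hI]
    push_cast at hit
    nlinarith
  · have hI : ⌊x + 1 / 2⌋₊ = n + 1 := by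
      rw [Nat.floor_eq_iff (by positivity)]
      push_cast
      constructor <;> linarith
    have hit := add_mul_le_of_succ_add_le (n := n + 1 - l) (fun k hk => h k (by omega)) l
    rw [show n + 1 - l + l = n + 1 by omega] at hit
    rw [hI]
    nlinarith

/-- A lower bound of order `c^k k^{-a k}` on the tail gives `-log` of order at most `n log n`. -/
theorem exists_neg_log_tail_le {p : ℕ → ℝ} {a c : ℝ} (hp : Summable p)
    (hnn : ∀ k, 0 ≤ p k) (ha : 0 < a) (hc : 0 < c)
    (hlow : ∀ᶠ k : ℕ in atTop, c ^ k * (k : ℝ) ^ (-(a * k)) ≤ p k) :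
    ∃ C : ℝ, 1 ≤ C ∧ ∀ᶠ n : ℕ in atTop,
      -log (∑' j : ℕ, p (n + 2 + j)) ≤ C * n * log n := by
  refine ⟨2 * |log c| + 4 * a + 1, by linarith [abs_nonneg (log c)], ?_⟩
  have h2 := (tendsto_add_atTop_nat 2).eventually hlow
  have hlog1 : ∀ᶠ n : ℕ in atTop, 1 ≤ log (n : ℝ) :=
    (tendsto_log_atTop.comp tendsto_natCast_atTop_atTop).eventually_ge_atTop 1
  filter_upwards [h2, hlog1, eventually_ge_atTop 2] with n hn hL hn2
  have hn2' : (2 : ℝ) ≤ n := by exact_mod_cast hn2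
  have hk0 : (0 : ℝ) < ((n + 2 : ℕ) : ℝ) := by positivity
  have h1 := log_le_log (by positivity) (hn.trans (le_tsum_nat_shift hp hnn (n + 2)))
  rw [log_mul (by positivity) (by positivity), log_pow, log_rpow hk0] at h1
  have hk : ((n + 2 : ℕ) : ℝ) ≤ 2 * n := by push_cast; linarith
  have hlogk : log ((n + 2 : ℕ) : ℝ) ≤ 2 * log n := by
    rw [← Nat.cast_ofNat (R := ℝ), ← log_pow]
    exact log_le_log hk0 (by push_cast at hk ⊢; nlinarith)
  have hA : -(((n + 2 : ℕ) : ℝ) * log c) ≤ 2 * n * |log c| * log n := by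
    calc -(((n + 2 : ℕ) : ℝ) * log c) = ((n + 2 : ℕ) : ℝ) * (-log c) := by ring
      _ ≤ (2 * n) * |log c| := by
        have := neg_le_abs (log c)
        have := abs_nonneg (log c)
        nlinarith
      _ ≤ 2 * n * |log c| * log n := le_mul_of_one_le_right (by positivity) hL
  have hB : a * ((n + 2 : ℕ) : ℝ) * log ((n + 2 : ℕ) : ℝ) ≤ a * (2 * n) * (2 * log n) := by
    gcongr
  have hC : 0 ≤ n * log n := by positivity
  nlinarith

theorem inv_mul_le_log_div_self {x C n : ℝ} (hx : exp 1 ≤ x) (hC : 1 ≤ C) (hn : 1 ≤ log n)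
    (hn0 : 0 < n) (hxn : x ≤ C * n * log n) : (C * n)⁻¹ ≤ log x / x := by
  have h1 := log_div_self_antitoneOn hx (hx.trans hxn) hxn
  refine le_trans ?_ h1
  have hy : log n ≤ log (C * n * log n) :=
    log_le_log hn0 ((le_mul_of_one_le_left hn0.le hC).trans
      (le_mul_of_one_le_right (by positivity) hn))
  calc (C * n)⁻¹ = log n / (C * n * log n) := by field_simp
    _ ≤ log (C * n * log n) / (C * n * log n) := by gcongr

/-- **Lemma 3.2 (ii)** in abstract form: if the probability mass function `p` satisfies
the two-sided estimates of Proposition 2.2, `G` is its strict tail, `A ρ = G_c⁻¹(1/ρ)`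
and `I ρ = ⌊A ρ + 1/2⌋`, then for every `l ≥ 0`,
`((log log ρ)/(log ρ))^{2l/(d-1)} · ρ · P(D⁰ ≥ I_ρ - l) → ∞` as `ρ → ∞`. -/
theorem tail_exceedance_tendsto_atTop
    (d : ℕ) (hd : 2 ≤ d) (m : ℕ) (p : ℕ → ℝ)
    (hpnn : ∀ k, 0 ≤ p k) (hppos : ∀ k, m ≤ k → 0 < p k)
    (hpsum : ∑' k : ℕ, p k = 1)
    (c₁ c₂ : ℝ) (hc₁ : 0 < c₁) (hc₂ : 0 < c₂)
    (hrec : ∀ᶠ k : ℕ in atTop,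
      p k ≤ c₂ * (k : ℝ) ^ (-(2 : ℝ) / ((d : ℝ) - 1)) * p (k - 1))
    (hlow : ∀ᶠ k : ℕ in atTop,
      c₁ ^ k * (k : ℝ) ^ (-(2 * (k : ℝ)) / ((d : ℝ) - 1)) ≤ p k)
    -- `G` is the strict tail `G(k) = Σ_{j > k} p(j)`:
    (G : ℕ → ℝ) (hGdef : ∀ k : ℕ, G k = ∑' j : ℕ, p (k + 1 + j))
    -- `Gc` is the continuous log-linear extension of `G`:
    (Gc : ℝ → ℝ)
    (hGc : ∀ x : ℝ, (m : ℝ) ≤ x → Gc x =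
      Real.exp (Real.log (G ⌊x⌋₊) +
        (x - (⌊x⌋₊ : ℝ)) * (Real.log (G (⌊x⌋₊ + 1)) - Real.log (G ⌊x⌋₊))))
    -- `A ρ = G_c⁻¹(1/ρ)`:
    (A : ℝ → ℝ)
    (hA : ∀ᶠ ρ : ℝ in atTop, (m : ℝ) ≤ A ρ ∧ Gc (A ρ) = 1 / ρ) :
    ∀ l : ℕ,
      Tendsto (fun ρ : ℝ =>
        (Real.log (Real.log ρ) / Real.log ρ) ^ ((2 * (l : ℝ)) / ((d : ℝ) - 1)) *
          (ρ * ∑' j : ℕ, p ((⌊A ρ + 1 / 2⌋₊ - l) + j))) atTop atTop := by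

  intro l
  have hp : Summable p := by
    by_contra h
    simp [tsum_eq_zero_of_not_summable h] at hpsum
  have hd1 : (0 : ℝ) < (d : ℝ) - 1 := by
    have : (2 : ℝ) ≤ d := by exact_mod_cast hd
    linarith
  set a : ℝ := 2 / ((d : ℝ) - 1) with ha_def
  have ha : 0 < a := by positivity
  set S : ℕ → ℝ := fun n => ∑' j : ℕ, p (n + j) with hS_def
  have hSpos : ∀ n, 0 < S n := tsum_nat_shift_pos hp hpnn hppos
  have hSanti : Antitone S := antitone_nat_of_succ_le (tsum_nat_shift_succ_le hp hpnn)
  have hGS : ∀ k, G k = S (k + 1) := hGdef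
  have hdecr : ∀ᶠ k : ℕ in atTop, log (S (k + 1)) + (a * log k - log c₂) ≤ log (S k) :=
    eventually_log_tail_succ_add_le hp hpnn hppos ha hc₂
      (by simpa only [ha_def, neg_div] using hrec)
  obtain ⟨C, hC1, hC⟩ := exists_neg_log_tail_le (a := a) hp hpnn ha hc₁
    (by simpa only [ha_def, neg_div, div_mul_eq_mul_div] using hlow)
  have hlogρ : ∀ᶠ ρ : ℝ in atTop, 0 ≤ A ρ ∧ log ρ = -(log (S (⌊A ρ⌋₊ + 1)) +
      (A ρ - ⌊A ρ⌋₊) * (log (S (⌊A ρ⌋₊ + 2)) - log (S (⌊A ρ⌋₊ + 1)))) := by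
    filter_upwards [hA] with ρ hρ
    refine ⟨(Nat.cast_nonneg m).trans hρ.1, ?_⟩
    have h := congrArg log (hGc _ hρ.1)
    rw [hρ.2, log_exp, one_div, log_inv, hGS, hGS] at h
    linarith
  have hlogle : ∀ᶠ ρ : ℝ in atTop, log ρ ≤ -log (S (⌊A ρ⌋₊ + 2)) := by
    filter_upwards [hlogρ] with ρ hρ
    have hlt := Nat.lt_floor_add_one (A ρ)
    have hmono := log_le_log (hSpos _) (hSanti (Nat.le_succ (⌊A ρ⌋₊ + 1)))
    rw [hρ.2]
    simp only [Nat.succ_eq_add_one, add_assoc, Nat.reduceAdd] at hmono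
    nlinarith
  have hn : Tendsto (fun ρ => ⌊A ρ⌋₊) atTop atTop := by
    refine tendsto_atTop.2 fun N => ?_
    filter_upwards [hlogle, tendsto_log_atTop.eventually_gt_atTop (-log (S (N + 2)))]
      with ρ h1 h2
    by_contra! hlt
    have := log_le_log (hSpos _) (hSanti (show ⌊A ρ⌋₊ + 2 ≤ N + 2 by omega))
    linarith
  have hlogn : Tendsto (fun n : ℕ => log (n : ℝ)) atTop atTop :=
    tendsto_log_atTop.comp tendsto_natCast_atTop_atTop
  have hdecr' : ∀ᶠ n : ℕ in atTop, ∀ k, n - l ≤ k →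
      log (S (k + 1)) + (a * (log n - log 2) - log c₂) ≤ log (S k) := by
    obtain ⟨K, hK⟩ := eventually_atTop.1 hdecr
    filter_upwards [eventually_ge_atTop (K + l), eventually_ge_atTop (2 * l + 1)]
      with n hnK hnl k hk
    have hn0 : (0 : ℝ) < n := by exact_mod_cast (by omega : 0 < n)
    have hle : log n - log 2 ≤ log k := by
      rw [← log_div hn0.ne' two_ne_zero]
      refine log_le_log (by positivity) ?_
      rw [div_le_iff₀ two_pos]
      exact_mod_cast (by omega : n ≤ k * 2)
    have := hK k (by omega)
    nlinarith
  have hβ : ∀ᶠ n : ℕ in atTop, 0 ≤ a * (log (n : ℝ) - log 2) - log c₂ := by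
    filter_upwards [hlogn.eventually_ge_atTop (log 2 + log c₂ / a)] with n h
    have : log c₂ / a * a = log c₂ := div_mul_cancel₀ _ ha.ne'
    nlinarith
  have hlim : Tendsto (fun ρ : ℝ => exp (a / 2 * log (⌊A ρ⌋₊ : ℝ) -
      (a * l * log C + (l + 1 / 2) * (a * log 2 + log c₂)))) atTop atTop :=
    tendsto_exp_atTop.comp <| tendsto_atTop_add_const_right _ _ <|
      (hlogn.comp hn).const_mul_atTop (half_pos ha)
  refine tendsto_atTop_mono' _ ?_ hlim
  filter_upwards [hlogρ, hlogle, hn.eventually hdecr', hn.eventually hβ, hn.eventually hC,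
    hn.eventually (hlogn.eventually_ge_atTop 1), hn.eventually (eventually_ge_atTop (l + 1)),
    tendsto_log_atTop.eventually_ge_atTop (exp 1), eventually_gt_atTop 0]
    with ρ h1 h2 h3 h4 h5 h6 h7 h8 hρ0
  have hn0 : (0 : ℝ) < (⌊A ρ⌋₊ : ℝ) := by exact_mod_cast (by omega : 0 < ⌊A ρ⌋₊)
  have hkey := half_step_le_add_log_tail (g := fun k => log (S k)) (l := l) h1.1 h4 (by omega) h3
  simp only [← h1.2] at hkey
  have hfac := inv_mul_le_log_div_self h8 hC1 h6 hn0 (h2.trans h5)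
  have hCn : 0 < C * (⌊A ρ⌋₊ : ℝ) := by positivity
  have hfacpos : 0 < log (log ρ) / log ρ := (inv_pos.2 hCn).trans_le hfac
  have hlogfac := log_le_log (inv_pos.2 hCn) hfac
  rw [log_inv, log_mul (by positivity) hn0.ne'] at hlogfac
  have hSI := hSpos (⌊A ρ + 1 / 2⌋₊ - l)
  change _ ≤ _ * (ρ * S (⌊A ρ + 1 / 2⌋₊ - l))
  rw [← le_log_iff_exp_le (by positivity), log_mul (by positivity) (by positivity),
    log_rpow hfacpos, log_mul hρ0.ne' hSI.ne',
    show 2 * (l : ℝ) / ((d : ℝ) - 1) = a * l by rw [ha_def]; ring]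
  have hmul := mul_le_mul_of_nonneg_left hlogfac (by positivity : 0 ≤ a * (l : ℝ))
  linarith
end

section
/- Let N be a random variable with the Poisson distribution of parameter μ > 0. Then, as the integer t → ∞, E[ N · 1_{N ≥ t} ] ~ t · P(N ≥ t), i.e. the ratio E[N · 1_{N ≥ t}] / (t · P(N ≥ t)) converges to 1. -/
open MeasureTheory Filter

lemma measureReal_le_eq_tsum {Ω : Type*} [MeasurableSpace Ω] {P : Measure Ω}
    [IsProbabilityMeasure P] {N : Ω → ℕ} (hN : Measurable N) {p : ℕ → ℝ}
    (hp : ∀ n, P.real (N ⁻¹' {n}) = p n) (t : ℕ) :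
    P.real {ω | t ≤ N ω} = ∑' n, p n * (if t ≤ n then 1 else 0) := by
  have hs : MeasurableSet {ω | t ≤ N ω} := hN (measurableSet_Ici (a := t))
  have hint : Integrable (fun n : ℕ => if t ≤ n then (1 : ℝ) else 0) (P.map N) := by
    have := Measure.isProbabilityMeasure_map (μ := P) hN.aemeasurable
    refine Integrable.of_bound (C := 1) (by fun_prop) (.of_forall fun n => ?_)
    split_ifs <;> simp
  calc P.real {ω | t ≤ N ω} = ∫ ω, (if t ≤ N ω then (1 : ℝ) else 0) ∂P := by
        rw [← integral_indicator_one hs]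
        simp [Set.indicator_apply]
    _ = ∫ n, (if t ≤ n then (1 : ℝ) else 0) ∂(P.map N) :=
        (integral_map (f := fun n : ℕ => if t ≤ n then (1 : ℝ) else 0)
          hN.aemeasurable (by fun_prop)).symm
    _ = _ := by
        rw [integral_countable hint]
        simp_rw [map_measureReal_apply hN (measurableSet_singleton _), hp, smul_eq_mul]

/-- If the nonnegative weights `p` satisfy the Poisson recursion `(n + 1) p (n + 1) = r p n`, their
truncated mean lies between `t` and `t + r` times the tail. -/
lemma tsum_truncated_mean_bounds {p : ℕ → ℝ} {r : ℝ} (hp : Summable p) (hp0 : ∀ n, 0 ≤ p n)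
    (hrec : ∀ n : ℕ, (n + 1 : ℝ) * p (n + 1) = r * p n) (t : ℕ) :
    t * (∑' n, p n * (if t ≤ n then 1 else 0)) ≤
        ∑' n : ℕ, p n * (n * (if t ≤ n then 1 else 0)) ∧
      ∑' n : ℕ, p n * (n * (if t ≤ n then 1 else 0)) ≤
        (t + r) * (∑' n, p n * (if t ≤ n then 1 else 0)) := by
  have hq : Summable fun n => p n * (if t ≤ n then (1 : ℝ) else 0) := by
    refine hp.of_nonneg_of_le (fun n => ?_) (fun n => ?_) <;> split_ifs <;> simp [hp0]
  have hm : Summable fun n : ℕ => p n * (n : ℝ) := by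
    rw [← summable_nat_add_iff 1]
    refine (hp.mul_left r).congr fun n => ?_
    rw [← hrec]; push_cast; ring
  have hmt : Summable fun n : ℕ => p n * (n * (if t ≤ n then (1 : ℝ) else 0)) := by
    refine hm.of_nonneg_of_le (fun n => ?_) (fun n => ?_) <;> split_ifs <;>
      simp [hp0, mul_nonneg]
  constructor
  · rw [← tsum_mul_left]
    refine (hq.mul_left _).tsum_le_tsum (fun n => ?_) hmt
    split_ifs with h
    · have : (t : ℝ) ≤ n := by exact_mod_cast h
      nlinarith [hp0 n]
    · simp
  · have hs : Summable fun n : ℕ => if n + 1 = t then (t : ℝ) * p t else 0 :=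
      summable_of_hasFiniteSupport <| (Set.finite_Iic t).subset fun n hn => by
        simp only [Function.mem_support, ne_eq, ite_eq_right_iff, not_forall] at hn
        obtain ⟨h, -⟩ := hn
        simp only [Set.mem_Iic]; omega
    have hterm : ∀ n : ℕ, p (n + 1) * ((n + 1 : ℕ) * (if t ≤ n + 1 then (1 : ℝ) else 0)) =
        r * (p n * (if t ≤ n then 1 else 0)) + if n + 1 = t then (t : ℝ) * p t else 0 := by
      intro n
      rcases lt_trichotomy (n + 1) t with h | h | h
      · simp [h.not_ge, h.ne, show ¬ t ≤ n by omega]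
      · subst h
        simp [mul_comm]
      · simp [h.le, h.ne', show t ≤ n by omega, ← hrec, mul_comm]
    have htail : t * p t ≤ t * ∑' n, p n * (if t ≤ n then (1 : ℝ) else 0) := by
      gcongr
      simpa using hq.le_tsum t fun n _ => by split_ifs <;> simp [hp0]
    have hone : ∑' n : ℕ, (if n + 1 = t then (t : ℝ) * p t else 0) ≤ t * p t := by
      cases t with
      | zero => simp
      | succ k => simp [tsum_ite_eq]
    rw [hmt.tsum_eq_zero_add]
    simp_rw [hterm]
    rw [(hq.mul_left r).tsum_add hs, tsum_mul_left]
    simp only [CharP.cast_eq_zero, zero_mul, mul_zero, zero_add]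
    linarith

/-- Truncated mean of a Poisson random variable: if `N` is Poisson with parameter
`μ > 0`, then `E[N · 1_{N ≥ t}] ~ t · P(N ≥ t)` as the integer `t → ∞`. -/
theorem poisson_truncated_mean_equiv
    {Ω : Type*} [MeasurableSpace Ω] (P : Measure Ω) [IsProbabilityMeasure P]
    (N : Ω → ℕ) (hNmeas : Measurable N) (μ : ℝ) (hμ : 0 < μ)
    (hN : ∀ n : ℕ, P {ω | N ω = n} =
      ENNReal.ofReal (Real.exp (-μ) * μ ^ n / n.factorial)) :
    Tendsto (fun t : ℕ =>
      (∫ ω, (N ω : ℝ) * (if t ≤ N ω then 1 else 0) ∂P) /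
        ((t : ℝ) * (P {ω | t ≤ N ω}).toReal)) atTop (nhds 1) := by
  lift μ to NNReal using hμ.le
  have hlaw : P.map N = ProbabilityTheory.poissonMeasure μ := by
    refine Measure.ext_of_singleton fun n => ?_
    rw [Measure.map_apply hNmeas (measurableSet_singleton n),
      ProbabilityTheory.poissonMeasure_singleton]
    exact hN n
  set p : ℕ → ℝ := fun n => Real.exp (-μ) * μ ^ n / n.factorial with hpdef
  have hpos : ∀ n, 0 < p n := fun n => by positivity
  have hp : ∀ n, P.real (N ⁻¹' {n}) = p n := fun n => by
    rw [← map_measureReal_apply hNmeas (measurableSet_singleton n), hlaw,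
      ProbabilityTheory.poissonMeasure_real_singleton]
  have hrec : ∀ n : ℕ, (n + 1 : ℝ) * p (n + 1) = μ * p n := fun n => by
    simp only [hpdef, Nat.factorial_succ]
    push_cast
    field_simp
    ring
  have hbounds := tsum_truncated_mean_bounds (p := p)
    (ProbabilityTheory.hasSum_one_poissonMeasure μ).summable (fun n => (hpos n).le) hrec
  have hmean : ∀ t : ℕ, ∫ ω, (N ω : ℝ) * (if t ≤ N ω then 1 else 0) ∂P =
      ∑' n : ℕ, p n * (n * (if t ≤ n then 1 else 0)) := fun t => by
    rw [← integral_map (f := fun n : ℕ => (n : ℝ) * (if t ≤ n then 1 else 0))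
      hNmeas.aemeasurable (by fun_prop), hlaw, ProbabilityTheory.integral_poissonMeasure]
    rfl
  have htail := measureReal_le_eq_tsum hNmeas hp
  have htail_pos : ∀ t : ℕ, 0 < P.real {ω | t ≤ N ω} := fun t =>
    (hp t ▸ hpos t).trans_le <| measureReal_mono fun ω (hω : N ω = t) => hω.ge
  simp_rw [← measureReal_def, hmean]
  simp_rw [← htail] at hbounds
  have hlim : Tendsto (fun t : ℕ => 1 + (μ : ℝ) / t) atTop (nhds 1) := by
    simpa using (tendsto_const_div_atTop_nhds_zero_nat (μ : ℝ)).const_add 1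
  refine tendsto_of_tendsto_of_tendsto_of_le_of_le' tendsto_const_nhds hlim ?_ ?_
  all_goals
    filter_upwards [eventually_gt_atTop 0] with t ht
    have ht' : (0 : ℝ) < t := by exact_mod_cast ht
    have hden := mul_pos ht' (htail_pos t)
  · rw [le_div_iff₀ hden, one_mul]
    exact (hbounds t).1
  · rw [div_le_iff₀ hden]
    refine (hbounds t).2.trans_eq ?_
    field_simp
end
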